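/- arXiv:1311.3323 — 3 statements merged into one kernel-verified Lean document; each statement's English description precedes it below -/
import Mathlib

section
/- Let C ⊆ ℝ² be a convex body (a compact convex set with nonempty interior) and let Γ be a barrier for C that is the union of a countable family of rectifiable curves γᵢ (continuous maps γᵢ : [0,1] → ℝ² of finite total variation) with finite total length L = Σᵢ |γᵢ|, where |γᵢ| denotes the total variation (length) of γᵢ. Then for every ε > 0 there exists a barrier Γ_ε for C that is the union of a countable family of closed straight-line segments whose total length is at most (1 + ε) · L. -/
open MeasureTheory Set

noncomputable section

/-- A point in the plane. -/
abbrev Pt : Type := EuclideanSpace ℝ (Fin 2)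

/-- A line in ℝ² is a set {p + t • v : t ∈ ℝ} for some p, v with v ≠ 0. -/
def IsLine (l : Set Pt) : Prop :=
  ∃ p v : Pt, v ≠ 0 ∧ l = {q : Pt | ∃ t : ℝ, q = p + t • v}

/-- Γ is a barrier (opaque set) for C if every line meeting C also meets Γ. -/
def IsBarrier (Γ C : Set Pt) : Prop :=
  ∀ l : Set Pt, IsLine l → (l ∩ C).Nonempty → (l ∩ Γ).Nonempty

/-- The closed unit square U = [0,1] × [0,1]. -/
def unitSquare : Set Pt := {p : Pt | p 0 ∈ Icc (0:ℝ) 1 ∧ p 1 ∈ Icc (0:ℝ) 1}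

/-- If a line meets a connected chain's hull it meets the chain. -/
lemma zero_on_segment (m0 m1 c : ℝ) (P Q : Pt)
    (h : (m0 * P 0 + m1 * P 1 + c) * (m0 * Q 0 + m1 * Q 1 + c) ≤ 0) :
    ∃ q ∈ segment ℝ P Q, m0 * q 0 + m1 * q 1 + c = 0 := by
  set x := m0 * P 0 + m1 * P 1 + c with hx
  set y := m0 * Q 0 + m1 * Q 1 + c with hy
  by_cases hxy : x = y
  · have hx0 : x = 0 := by
      rw [← hxy] at h
      nlinarith [sq_nonneg x]
    exact ⟨P, left_mem_segment ℝ P Q, hx0⟩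
  · have hne : x - y ≠ 0 := sub_ne_zero.mpr hxy
    have hpos : 0 < (x - y) ^ 2 := by positivity
    refine ⟨(1 - x / (x - y)) • P + (x / (x - y)) • Q, ⟨1 - x / (x - y), x / (x - y), ?_, ?_, by ring, rfl⟩, ?_⟩
    · have : 1 - x / (x - y) = (y * (y - x)) / (x - y) ^ 2 := by field_simp; ring
      rw [this]
      apply div_nonneg _ hpos.le
      nlinarith [sq_nonneg y]
    · have : x / (x - y) = (x * (x - y)) / (x - y) ^ 2 := by field_simp
      rw [this]
      apply div_nonneg _ hpos.le
      nlinarith [sq_nonneg x]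
    · simp only [PiLp.add_apply, PiLp.smul_apply, smul_eq_mul]
      have e : m0 * ((1 - x / (x - y)) * P 0 + x / (x - y) * Q 0)
          + m1 * ((1 - x / (x - y)) * P 1 + x / (x - y) * Q 1) + c
          = (1 - x / (x - y)) * x + x / (x - y) * y := by
        rw [hx, hy]; ring
      rw [e]
      field_simp
      ring

lemma line_eq (l : Set Pt) (hl : IsLine l) :
    ∃ m0 m1 c : ℝ, ∀ q : Pt, q ∈ l ↔ m0 * q 0 + m1 * q 1 + c = 0 := by
  obtain ⟨p, v, hv, rfl⟩ := hl
  refine ⟨v 1, - v 0, v 0 * p 1 - v 1 * p 0, fun q => ?_⟩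
  have hn : 0 < v 0 ^ 2 + v 1 ^ 2 := by
    by_contra hcon
    apply hv
    have h0 : v 0 = 0 := by nlinarith [sq_nonneg (v 0), sq_nonneg (v 1)]
    have h1 : v 1 = 0 := by nlinarith [sq_nonneg (v 0), sq_nonneg (v 1)]
    ext i
    fin_cases i <;> simp [h0, h1]
  constructor
  · rintro ⟨t, rfl⟩
    simp only [PiLp.add_apply, PiLp.smul_apply, smul_eq_mul]
    ring
  · intro h
    refine ⟨((q 0 - p 0) * v 0 + (q 1 - p 1) * v 1) / (v 0 ^ 2 + v 1 ^ 2), ?_⟩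
    ext i
    fin_cases i
    · simp only [Fin.zero_eta, PiLp.add_apply, PiLp.smul_apply, smul_eq_mul]
      field_simp
      linear_combination (v 1) * h
    · simp only [Fin.mk_one, PiLp.add_apply, PiLp.smul_apply, smul_eq_mul]
      field_simp
      linear_combination (-v 0) * h

lemma ellipse_bounds (x y s t d l w : ℝ) (hx : 0 ≤ x) (hy : 0 ≤ y) (hw : 0 ≤ w) (hl : 0 ≤ l)
    (hw2 : w ^ 2 = l ^ 2 - d ^ 2)
    (hx2 : x ^ 2 = (s + d / 2) ^ 2 + t ^ 2) (hy2 : y ^ 2 = (s - d / 2) ^ 2 + t ^ 2)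
    (h : x + y ≤ l) : |s| ≤ l / 2 ∧ |t| ≤ w / 2 := by
  constructor
  · have h1 : |s + d / 2| ≤ x := abs_le_of_sq_le_sq (by nlinarith [sq_nonneg t]) hx
    have h2 : |s - d / 2| ≤ y := abs_le_of_sq_le_sq (by nlinarith [sq_nonneg t]) hy
    rw [abs_le] at *
    constructor <;> linarith
  · have hxy : t ^ 2 - (s + d / 2) * (s - d / 2) ≤ x * y := by
      apply le_of_abs_le
      apply abs_le_of_sq_le_sq _ (mul_nonneg hx hy)
      rw [mul_pow, hx2, hy2]
      nlinarith [sq_nonneg (t * (s + d / 2) + t * (s - d / 2))]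
    have h4 : (x + y) ^ 2 ≤ l ^ 2 := pow_le_pow_left₀ (by linarith) h 2
    apply abs_le_of_sq_le_sq _ (by linarith)
    nlinarith

lemma dist_sq_coord (p q : Pt) : dist p q ^ 2 = (p 0 - q 0) ^ 2 + (p 1 - q 1) ^ 2 := by
  rw [EuclideanSpace.dist_eq, Real.sq_sqrt (by positivity)]
  simp [Fin.sum_univ_two, Real.dist_eq, sq_abs]

lemma exists_dir (A B : Pt) : ∃ u0 u1 : ℝ, u0 ^ 2 + u1 ^ 2 = 1 ∧
    B 0 - A 0 = dist A B * u0 ∧ B 1 - A 1 = dist A B * u1 := by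
  by_cases h : dist A B = 0
  · have : A = B := dist_eq_zero.mp h
    subst this
    exact ⟨1, 0, by norm_num, by simp, by simp⟩
  · refine ⟨(B 0 - A 0) / dist A B, (B 1 - A 1) / dist A B, ?_, by field_simp, by field_simp⟩
    have := dist_sq_coord A B
    field_simp
    rw [this]; ring

lemma dist_le_of_sq (p q : Pt) (r : ℝ) (hr : 0 ≤ r)
    (h : (p 0 - q 0) ^ 2 + (p 1 - q 1) ^ 2 = r ^ 2) : dist p q = r := by
  rw [← dist_sq_coord] at h
  exact (pow_left_inj₀ dist_nonneg hr (by norm_num)).mp h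

/-- The three sides of a rectangle containing the ellipse with foci `A`, `B`. -/
lemma geom (A B : Pt) (l : ℝ) (hl : dist A B ≤ l) :
    ∃ P Q : Fin 3 → Pt,
      (∀ L : Set Pt, IsLine L → ∀ q ∈ L, dist A q + dist q B ≤ l →
        ∃ k, (L ∩ segment ℝ (P k) (Q k)).Nonempty) ∧
      ∑ k, dist (P k) (Q k) ≤ l + 2 * √(l ^ 2 - dist A B ^ 2) := by
  obtain ⟨u0, u1, hu, hB0, hB1⟩ := exists_dir A B
  set d := dist A B with hd
  have hd0 : 0 ≤ d := dist_nonneg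
  have hl0 : 0 ≤ l := hd0.trans hl
  set w := √(l ^ 2 - d ^ 2) with hw
  have hw0 : 0 ≤ w := Real.sqrt_nonneg _
  have hw2 : w ^ 2 = l ^ 2 - d ^ 2 := Real.sq_sqrt (by nlinarith)
  let R : ℝ → ℝ → Pt := fun s t =>
    !₂[A 0 + (d / 2 + s) * u0 - t * u1, A 1 + (d / 2 + s) * u1 + t * u0]
  have R0 : ∀ s t, (R s t) 0 = A 0 + (d / 2 + s) * u0 - t * u1 := fun s t => by simp [R]
  have R1 : ∀ s t, (R s t) 1 = A 1 + (d / 2 + s) * u1 + t * u0 := fun s t => by simp [R]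
  let P1 := R (-(l / 2)) (w / 2)
  let P2 := R (-(l / 2)) (-(w / 2))
  let P3 := R (l / 2) (-(w / 2))
  let P4 := R (l / 2) (w / 2)
  refine ⟨![P1, P2, P3], ![P2, P3, P4], ?_, ?_⟩
  · intro L hL q hq hdist
    obtain ⟨m0, m1, c, hm⟩ := line_eq L hL
    have hq0 := (hm q).mp hq
    by_contra hcon
    push Not at hcon
    have key : ∀ k, 0 < (m0 * (![P1, P2, P3] k) 0 + m1 * (![P1, P2, P3] k) 1 + c) *
        (m0 * (![P2, P3, P4] k) 0 + m1 * (![P2, P3, P4] k) 1 + c) := by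
      intro k
      by_contra hk
      obtain ⟨z, hz, hz0⟩ := zero_on_segment m0 m1 c _ _ (not_lt.mp hk)
      have := hcon k
      have hmem : z ∈ L ∩ segment ℝ (![P1, P2, P3] k) (![P2, P3, P4] k) := ⟨(hm z).mpr hz0, hz⟩
      rw [this] at hmem
      exact hmem
    have k0 := key 0
    have k1 := key 1
    have k2 := key 2
    simp only [Matrix.cons_val_zero, Matrix.cons_val_one, Matrix.cons_val, P1, P2, P3, P4, R0, R1]
      at k0 k1 k2
    clear key hcon
    set s := (q 0 - A 0) * u0 + (q 1 - A 1) * u1 - d / 2 with hs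
    set t := -(q 0 - A 0) * u1 + (q 1 - A 1) * u0 with ht
    have hqs0 : q 0 = A 0 + (d / 2 + s) * u0 - t * u1 := by
      rw [hs, ht]; linear_combination (-(q 0 - A 0)) * hu
    have hqs1 : q 1 = A 1 + (d / 2 + s) * u1 + t * u0 := by
      rw [hs, ht]; linear_combination (-(q 1 - A 1)) * hu
    have hb := ellipse_bounds (dist A q) (dist q B) s t d l w dist_nonneg dist_nonneg hw0 hl0 hw2
      (by rw [dist_sq_coord, hqs0, hqs1]
          linear_combination ((s + d / 2) ^ 2 + t ^ 2) * hu)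
      (by have e0 : B 0 = A 0 + d * u0 := by linarith
          have e1 : B 1 = A 1 + d * u1 := by linarith
          rw [dist_sq_coord, hqs0, hqs1, e0, e1]
          linear_combination ((s - d / 2) ^ 2 + t ^ 2) * hu) hdist
    obtain ⟨hbs, hbt⟩ := hb
    rw [hqs0, hqs1] at hq0
    clear_value s t
    set fM := m0 * (A 0 + d / 2 * u0) + m1 * (A 1 + d / 2 * u1) + c with hfM
    set fu := m0 * u0 + m1 * u1 with hfu
    set fn := m1 * u0 - m0 * u1 with hfn
    have e : ∀ s t, m0 * (A 0 + (d / 2 + s) * u0 - t * u1) +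
        m1 * (A 1 + (d / 2 + s) * u1 + t * u0) + c = fM + s * fu + t * fn := by
      intro s t; rw [hfM, hfu, hfn]; ring
    rw [e] at hq0
    simp only [e] at k0 k1 k2
    have hsu : |s * fu| ≤ l / 2 * |fu| := by
      rw [abs_mul]; exact mul_le_mul_of_nonneg_right hbs (abs_nonneg _)
    have htn : |t * fn| ≤ w / 2 * |fn| := by
      rw [abs_mul]; exact mul_le_mul_of_nonneg_right hbt (abs_nonneg _)
    rw [abs_le] at hsu htn
    rcases mul_pos_iff.mp k0 with ⟨a1, a2⟩ | ⟨a1, a2⟩ <;>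
    rcases mul_pos_iff.mp k1 with ⟨a3, a4⟩ | ⟨a3, a4⟩ <;>
    rcases mul_pos_iff.mp k2 with ⟨a5, a6⟩ | ⟨a5, a6⟩ <;>
    rcases abs_cases fu with ⟨b1, b2⟩ | ⟨b1, b2⟩ <;>
    rcases abs_cases fn with ⟨b3, b4⟩ | ⟨b3, b4⟩ <;>
    rw [b1] at hsu <;> rw [b3] at htn <;> linarith
  · have e1 : dist P1 P2 = w := dist_le_of_sq _ _ _ hw0 (by
      simp only [P1, P2, R0, R1]; linear_combination w ^ 2 * hu)
    have e2 : dist P2 P3 = l := dist_le_of_sq _ _ _ hl0 (by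
      simp only [P3, P2, R0, R1]; linear_combination l ^ 2 * hu)
    have e3 : dist P3 P4 = w := dist_le_of_sq _ _ _ hw0 (by
      simp only [P3, P4, R0, R1]; linear_combination w ^ 2 * hu)
    simp only [Fin.sum_univ_three, Matrix.cons_val_zero, Matrix.cons_val_one, Matrix.cons_val]
    linarith

lemma two_dist_le (g : ℝ → Pt) (a b x : ℝ) (hx : x ∈ Icc a b)
    (hfin : eVariationOn g (Icc a b) ≠ ⊤) :
    dist (g a) (g x) + dist (g x) (g b) ≤ (eVariationOn g (Icc a b)).toReal := by
  have h1 : edist (g a) (g x) ≤ eVariationOn g (Icc a x) :=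
    eVariationOn.edist_le g ⟨le_rfl, hx.1⟩ ⟨hx.1, le_rfl⟩
  have h2 : edist (g x) (g b) ≤ eVariationOn g (Icc x b) :=
    eVariationOn.edist_le g ⟨le_rfl, hx.2⟩ ⟨hx.2, le_rfl⟩
  have h3 := eVariationOn.Icc_add_Icc g (s := univ) hx.1 hx.2 (mem_univ x)
  simp only [univ_inter] at h3
  have h4 : edist (g a) (g x) + edist (g x) (g b) ≤ eVariationOn g (Icc a b) :=
    (add_le_add h1 h2).trans h3.le
  have h5 := ENNReal.toReal_mono hfin h4
  rwa [ENNReal.toReal_add (edist_ne_top _ _) (edist_ne_top _ _), ← dist_edist, ← dist_edist] at h5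

lemma sqrt_bound (l d τ : ℝ) (hd : 0 ≤ d) (hdl : d ≤ l) (hτ : 0 < τ) :
    2 * √(l ^ 2 - d ^ 2) ≤ (l - d) / τ + 2 * τ * l := by
  have h1 : l ^ 2 - d ^ 2 = ((l - d) / τ) * (τ * (l + d)) := by field_simp; ring
  have ha : 0 ≤ (l - d) / τ := div_nonneg (by linarith) hτ.le
  have hb : 0 ≤ τ * (l + d) := mul_nonneg hτ.le (by linarith)
  have h2 : 2 * √(l ^ 2 - d ^ 2) ≤ (l - d) / τ + τ * (l + d) := by
    have : √(l ^ 2 - d ^ 2) ≤ ((l - d) / τ + τ * (l + d)) / 2 := by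
      apply Real.sqrt_le_iff.mpr
      constructor
      · linarith
      · rw [h1]; nlinarith [sq_nonneg ((l - d) / τ - τ * (l + d))]
    linarith
  nlinarith

lemma piece (g : ℝ → Pt) (a b : ℝ) (hab : a ≤ b) (hfin : eVariationOn g (Icc a b) ≠ ⊤)
    (τ : ℝ) (hτ : 0 < τ) :
    ∃ P Q : Fin 3 → Pt,
      (∀ L : Set Pt, IsLine L → (L ∩ g '' Icc a b).Nonempty →
        ∃ k, (L ∩ segment ℝ (P k) (Q k)).Nonempty) ∧
      ∑ k, dist (P k) (Q k) ≤ (eVariationOn g (Icc a b)).toReal +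
        (((eVariationOn g (Icc a b)).toReal - dist (g a) (g b)) / τ +
          2 * τ * (eVariationOn g (Icc a b)).toReal) := by
  have hd : dist (g a) (g b) ≤ (eVariationOn g (Icc a b)).toReal := by
    have := two_dist_le g a b a ⟨le_rfl, hab⟩ hfin
    simpa using this
  obtain ⟨P, Q, h1, h2⟩ := geom (g a) (g b) _ hd
  refine ⟨P, Q, ?_, ?_⟩
  · rintro L hL ⟨q, hq, x, hx, rfl⟩
    exact h1 L hL _ hq (two_dist_le g a b x hx hfin)
  · have := sqrt_bound _ _ τ dist_nonneg hd hτ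
    linarith

lemma exists_partition (g : ℝ → Pt) (c : ENNReal) (hc : c < eVariationOn g (Icc 0 1)) :
    ∃ (N : ℕ) (u : ℕ → ℝ), Monotone u ∧ u 0 = 0 ∧ (∀ j, N ≤ j → u j = 1) ∧
      c ≤ ∑ j ∈ Finset.range N, edist (g (u j)) (g (u (j + 1))) := by
  unfold eVariationOn at hc
  obtain ⟨⟨n, v, hv, hvm⟩, hlt⟩ := lt_iSup_iff.mp hc
  simp only at hlt
  let u : ℕ → ℝ := fun j => if j = 0 then 0 else if j ≤ n + 1 then v (j - 1) else 1
  have us : ∀ i, i ≤ n → u (i + 1) = v i := by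
    intro i hi
    simp [u, hi]
  refine ⟨n + 2, u, ?_, by simp [u], ?_, ?_⟩
  · apply monotone_nat_of_le_succ
    intro j
    rcases Nat.eq_zero_or_pos j with rfl | hj
    · rw [us 0 (Nat.zero_le _)]
      simpa [u] using (hvm 0).1
    · obtain ⟨i, rfl⟩ : ∃ i, j = i + 1 := ⟨j - 1, by omega⟩
      by_cases h1 : i + 1 ≤ n
      · rw [us i (by omega), us (i + 1) h1]
        exact hv (Nat.le_succ i)
      · have e : u (i + 1 + 1) = 1 := by simp [u, h1]
        rw [e]
        by_cases h2 : i ≤ n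
        · rw [us i h2]; exact (hvm i).2
        · have : u (i + 1) = 1 := by simp [u, h2]
          rw [this]
  · intro j hj
    have h0 : j ≠ 0 := by omega
    have h1 : ¬ j ≤ n + 1 := by omega
    simp [u, h0, h1]
  · rw [Finset.sum_range_succ, Finset.sum_range_succ']
    refine hlt.le.trans ?_
    refine le_trans (le_of_eq ?_) (le_trans le_self_add le_self_add)
    apply Finset.sum_congr rfl
    intro i hi
    have hi' := Finset.mem_range.mp hi
    rw [us i (by omega), us (i + 1) (by omega), edist_comm]

lemma curve_aux (g : ℝ → Pt) (hfin : eVariationOn g (Icc 0 1) ≠ ⊤) (τ η : ℝ) (hτ : 0 < τ)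
    (N : ℕ) (u : ℕ → ℝ) (hu : Monotone u) (hu0 : u 0 = 0) (hu1 : ∀ j, N ≤ j → u j = 1)
    (hs : (eVariationOn g (Icc 0 1)).toReal - η ≤
      ∑ j ∈ Finset.range N, dist (g (u j)) (g (u (j + 1)))) :
    ∃ P Q : ℕ × Fin 3 → Pt,
      (∀ L : Set Pt, IsLine L → (L ∩ g '' Icc 0 1).Nonempty →
        ∃ k, (L ∩ segment ℝ (P k) (Q k)).Nonempty) ∧
      ∑' k, edist (P k) (Q k) ≤ ENNReal.ofReal ((eVariationOn g (Icc 0 1)).toReal +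
        (η / τ + 2 * τ * (eVariationOn g (Icc 0 1)).toReal)) := by
  have hmem : ∀ j, u j ∈ Icc (0 : ℝ) 1 := fun j =>
    ⟨hu0 ▸ hu (Nat.zero_le j), (hu (Nat.le_add_right j N)).trans (hu1 _ (by omega)).le⟩
  have hpf : ∀ j, eVariationOn g (Icc (u j) (u (j + 1))) ≠ ⊤ := fun j =>
    ne_top_of_le_ne_top hfin (eVariationOn.mono g (Icc_subset_Icc (hmem j).1 (hmem (j + 1)).2))
  choose P Q h1 h2 using fun j => piece g (u j) (u (j + 1)) (hu (Nat.le_succ j)) (hpf j) τ hτ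
  refine ⟨fun k => P k.1 k.2, fun k => Q k.1 k.2, ?_, ?_⟩
  · rintro L hL ⟨q, hq, x, hx, rfl⟩
    have hex : ∃ j, x ≤ u (j + 1) := ⟨N, by rw [hu1 _ (by omega)]; exact hx.2⟩
    classical
    have hj : x ∈ Icc (u (Nat.find hex)) (u (Nat.find hex + 1)) := by
      refine ⟨?_, Nat.find_spec hex⟩
      rcases Nat.eq_zero_or_pos (Nat.find hex) with h | h
      · rw [h, hu0]; exact hx.1
      · have := Nat.find_min hex (Nat.sub_one_lt_of_lt h)
        rw [Nat.sub_add_cancel h] at this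
        exact (not_le.mp this).le
    obtain ⟨k, hk⟩ := h1 _ L hL ⟨_, hq, x, hj, rfl⟩
    exact ⟨(_, k), hk⟩
  · have hsum : ∑ j ∈ Finset.range N, (eVariationOn g (Icc (u j) (u (j + 1)))).toReal
        = (eVariationOn g (Icc 0 1)).toReal := by
      rw [← ENNReal.toReal_sum (fun j _ => hpf j), eVariationOn.sum' g hu, hu0, hu1 N le_rfl]
    have hz : ∀ j ∉ Finset.range N, ∑ k, edist (P j k) (Q j k) = 0 := by
      intro j hj
      have hj' : N ≤ j := by simpa using hj
      have h := h2 j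
      have hv0 : eVariationOn g (Icc (1 : ℝ) 1) = 0 := by
        rw [Icc_self]; exact eVariationOn.subsingleton g subsingleton_singleton
      rw [hu1 j hj', hu1 (j + 1) (by omega), hv0] at h
      simp only [ENNReal.toReal_zero, dist_self, sub_zero, zero_div, mul_zero, add_zero] at h
      have h' := (Finset.sum_eq_zero_iff_of_nonneg (fun k _ => dist_nonneg)).mp
        (le_antisymm h (Finset.sum_nonneg fun k _ => dist_nonneg))
      apply Finset.sum_eq_zero
      intro k hk
      rw [edist_dist, h' k hk, ENNReal.ofReal_zero]
    rw [ENNReal.tsum_prod']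
    simp only [tsum_fintype]
    rw [tsum_eq_sum hz]
    have : ∀ j, ∑ k, edist (P j k) (Q j k) = ENNReal.ofReal (∑ k, dist (P j k) (Q j k)) := by
      intro j
      rw [ENNReal.ofReal_sum_of_nonneg (fun k _ => dist_nonneg)]
      simp only [edist_dist]
    simp only [this]
    rw [← ENNReal.ofReal_sum_of_nonneg (fun j _ => Finset.sum_nonneg fun k _ => dist_nonneg)]
    apply ENNReal.ofReal_le_ofReal
    refine (Finset.sum_le_sum fun j _ => h2 j).trans ?_
    rw [Finset.sum_add_distrib, Finset.sum_add_distrib, ← Finset.mul_sum, ← Finset.sum_div,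
      Finset.sum_sub_distrib, hsum]
    have : ((eVariationOn g (Icc 0 1)).toReal -
      ∑ j ∈ Finset.range N, dist (g (u j)) (g (u (j + 1)))) / τ ≤ η / τ :=
      div_le_div_of_nonneg_right (by linarith) hτ.le
    linarith

lemma curve (g : ℝ → Pt) (hfin : eVariationOn g (Icc 0 1) ≠ ⊤) (ε : ℝ) (hε : 0 < ε) :
    ∃ P Q : ℕ × Fin 3 → Pt,
      (∀ L : Set Pt, IsLine L → (L ∩ g '' Icc 0 1).Nonempty →
        ∃ k, (L ∩ segment ℝ (P k) (Q k)).Nonempty) ∧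
      ∑' k, edist (P k) (Q k) ≤ ENNReal.ofReal (1 + ε) * eVariationOn g (Icc 0 1) := by
  set l := (eVariationOn g (Icc 0 1)).toReal with hl
  have hl0 : 0 ≤ l := ENNReal.toReal_nonneg
  have key : ∃ (N : ℕ) (u : ℕ → ℝ), Monotone u ∧ u 0 = 0 ∧ (∀ j, N ≤ j → u j = 1) ∧
      l - ε ^ 2 * l / 8 ≤ ∑ j ∈ Finset.range N, dist (g (u j)) (g (u (j + 1))) := by
    rcases hl0.eq_or_lt with h0 | hpos
    · refine ⟨1, fun j => if j = 0 then 0 else 1, ?_, by simp, ?_, ?_⟩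
      · apply monotone_nat_of_le_succ
        intro j
        by_cases h : j = 0 <;> simp [h]
      · intro j hj
        have : j ≠ 0 := by omega
        simp [this]
      · rw [← h0]
        simp
    · have hc : ENNReal.ofReal (l - ε ^ 2 * l / 8) < eVariationOn g (Icc 0 1) := by
        rw [← ENNReal.ofReal_toReal hfin, ← hl]
        apply (ENNReal.ofReal_lt_ofReal_iff hpos).mpr
        have : 0 < ε ^ 2 * l := by positivity
        linarith
      obtain ⟨N, u, a, b, c, d⟩ := exists_partition g _ hc
      refine ⟨N, u, a, b, c, ?_⟩
      simp only [edist_dist] at d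
      rw [← ENNReal.ofReal_sum_of_nonneg (fun k _ => dist_nonneg)] at d
      exact (ENNReal.ofReal_le_ofReal_iff (Finset.sum_nonneg fun k _ => dist_nonneg)).mp d
  obtain ⟨N, u, a, b, c, d⟩ := key
  obtain ⟨P, Q, h1, h2⟩ := curve_aux g hfin (ε / 4) (ε ^ 2 * l / 8) (by positivity) N u a b c d
  refine ⟨P, Q, h1, h2.trans (le_of_eq ?_)⟩
  rw [← hl]
  conv_rhs => rw [← ENNReal.ofReal_toReal hfin, ← hl, ← ENNReal.ofReal_mul (by linarith)]
  congr 1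
  field_simp
  ring

/-- a rectifiable barrier for a convex body can be replaced, for any ε > 0,
by a countable segment barrier of total length at most (1 + ε) times the original length. -/
theorem rectifiable_barrier_to_segment_barrier
    (C : Set Pt) (hCcomp : IsCompact C) (hCconv : Convex ℝ C)
    (hCint : (interior C).Nonempty)
    (γ : ℕ → ℝ → Pt) (hcont : ∀ i, ContinuousOn (γ i) (Icc 0 1))
    (hrect : ∀ i, eVariationOn (γ i) (Icc 0 1) ≠ ⊤)
    (hfin : ∑' i, eVariationOn (γ i) (Icc 0 1) ≠ ⊤)
    (hbar : IsBarrier (⋃ i, γ i '' Icc 0 1) C)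
    (ε : ℝ) (hε : 0 < ε) :
    ∃ a b : ℕ → Pt,
      IsBarrier (⋃ i, segment ℝ (a i) (b i)) C ∧
      Summable (fun i => ‖b i - a i‖) ∧
      ∑' i, ‖b i - a i‖ ≤ (1 + ε) * (∑' i, eVariationOn (γ i) (Icc 0 1)).toReal := by
  choose P Q h1 h2 using fun i => curve (γ i) (hrect i) ε hε
  obtain ⟨hden⟩ : Nonempty (Denumerable (ℕ × ℕ × Fin 3)) := nonempty_denumerable _
  let e : ℕ ≃ ℕ × ℕ × Fin 3 := (Denumerable.eqv (ℕ × ℕ × Fin 3)).symm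
  have hsum : ∑' n, edist (P (e n).1 (e n).2) (Q (e n).1 (e n).2) ≤
      ENNReal.ofReal (1 + ε) * ∑' i, eVariationOn (γ i) (Icc 0 1) := by
    rw [e.tsum_eq (fun k : ℕ × ℕ × Fin 3 => edist (P k.1 k.2) (Q k.1 k.2)), ENNReal.tsum_prod',
      ← ENNReal.tsum_mul_left]
    exact ENNReal.tsum_le_tsum h2
  have htop : ENNReal.ofReal (1 + ε) * ∑' i, eVariationOn (γ i) (Icc 0 1) ≠ ⊤ :=
    ENNReal.mul_ne_top ENNReal.ofReal_ne_top hfin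
  have hnt : ∑' n, edist (P (e n).1 (e n).2) (Q (e n).1 (e n).2) ≠ ⊤ :=
    ne_top_of_le_ne_top htop hsum
  have hnorm : ∀ n, ‖Q (e n).1 (e n).2 - P (e n).1 (e n).2‖ =
      (edist (P (e n).1 (e n).2) (Q (e n).1 (e n).2)).toReal := by
    intro n
    rw [← dist_edist, dist_comm, dist_eq_norm]
  refine ⟨fun n => P (e n).1 (e n).2, fun n => Q (e n).1 (e n).2, ?_, ?_, ?_⟩
  · intro L hL hLC
    obtain ⟨q, hq, hqΓ⟩ := hbar L hL hLC
    obtain ⟨i, hi⟩ := mem_iUnion.mp hqΓ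
    obtain ⟨k, z, hz, hzs⟩ := h1 i L hL ⟨q, hq, hi⟩
    refine ⟨z, hz, mem_iUnion.mpr ⟨e.symm (i, k), ?_⟩⟩
    simpa using hzs
  · simp only [hnorm]
    exact ENNReal.summable_toReal hnt
  · simp only [hnorm]
    rw [← ENNReal.tsum_toReal_eq (fun n => edist_ne_top _ _)]
    have := ENNReal.toReal_mono htop hsum
    rwa [ENNReal.toReal_mul, ENNReal.toReal_ofReal (by linarith)] at this
end
end

section
/- Let C ⊆ ℝ² be a convex body (a compact convex set with nonempty interior) and let Γ be a segment barrier for C with total length L. Then L ≥ per(C)/2, where per(C) denotes the perimeter of C, i.e., the 1-dimensional Hausdorff measure of the topological boundary of C. -/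
open MeasureTheory Set

noncomputable section

/-- Projection to the direction `θ`. -/
def prj (θ : ℝ) : Pt →L[ℝ] ℝ :=
  Real.cos θ • EuclideanSpace.proj 0 + Real.sin θ • EuclideanSpace.proj 1

lemma prj_apply (θ : ℝ) (x : Pt) : prj θ x = Real.cos θ * x 0 + Real.sin θ * x 1 := by
  simp [prj]

lemma prj_ne_zero (θ : ℝ) : prj θ ≠ 0 := by
  intro h
  have h1 : prj θ !₂[Real.cos θ, Real.sin θ] = 0 := by rw [h]; rfl
  rw [prj_apply] at h1
  simp at h1
  nlinarith [Real.sin_sq_add_cos_sq θ]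

/-- The direction orthogonal to `θ`. -/
def dirv (θ : ℝ) : Pt := !₂[-Real.sin θ, Real.cos θ]

lemma dirv_ne_zero (θ : ℝ) : dirv θ ≠ 0 := by
  intro h
  have h0 := congrArg (fun x : Pt => x 0) h
  have h1 := congrArg (fun x : Pt => x 1) h
  simp [dirv] at h0 h1
  nlinarith [Real.sin_sq_add_cos_sq θ]

lemma exists_param (θ : ℝ) (x z : Pt) (h : prj θ x = prj θ z) :
    ∃ t : ℝ, x = z + t • dirv θ := by
  refine ⟨-Real.sin θ * (x 0 - z 0) + Real.cos θ * (x 1 - z 1), ?_⟩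
  rw [prj_apply, prj_apply] at h
  have hs := Real.sin_sq_add_cos_sq θ
  ext i
  fin_cases i
  · simp [dirv]
    linear_combination (Real.cos θ) * h - (x 0 - z 0) * hs
  · simp [dirv]
    linear_combination (Real.sin θ) * h - (x 1 - z 1) * hs

lemma prj_line (θ : ℝ) (z : Pt) (t : ℝ) : prj θ (z + t • dirv θ) = prj θ z := by
  simp [prj_apply, dirv]; ring

lemma not_between {C : Set Pt} (hC : Convex ℝ C) {z v : Pt} (hz : z ∈ interior C)
    {s t : ℝ} (hs : z + s • v ∈ frontier C) (ht : z + t • v ∈ frontier C)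
    (h0 : 0 < s) (hst : s < t) : False := by
  have h1 := hC.openSegment_interior_closure_subset_interior hz (frontier_subset_closure ht)
  have htp : 0 < t := h0.trans hst
  refine hs.2 (h1 ⟨1 - s / t, s / t, ?_, by positivity, by ring, ?_⟩)
  · have : s / t < 1 := by rw [div_lt_one htp]; exact hst
    linarith
  · have : (s / t) * t = s := by field_simp
    rw [smul_add, smul_smul, this, ← add_assoc, ← add_smul]
    simp

lemma same_sign {C : Set Pt} (hC : Convex ℝ C) {z v : Pt} (hz : z ∈ interior C)
    {s t : ℝ} (hs : z + s • v ∈ frontier C) (ht : z + t • v ∈ frontier C)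
    (h0 : 0 < s) (h1 : 0 < t) : s = t := by
  rcases lt_trichotomy s t with h | h | h
  · exact (not_between hC hz hs ht h0 h).elim
  · exact h
  · exact (not_between hC hz ht hs h1 h).elim

lemma no_three {C : Set Pt} (hC : Convex ℝ C) (θ : ℝ) {z x₁ x₂ x₃ : Pt} (hz : z ∈ interior C)
    (h₁ : x₁ ∈ frontier C) (h₂ : x₂ ∈ frontier C) (h₃ : x₃ ∈ frontier C)
    (e₁ : prj θ x₁ = prj θ z) (e₂ : prj θ x₂ = prj θ z) (e₃ : prj θ x₃ = prj θ z)
    (h12 : x₁ ≠ x₂) (h13 : x₁ ≠ x₃) (h23 : x₂ ≠ x₃) : False := by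
  obtain ⟨t₁, rfl⟩ := exists_param θ x₁ z e₁
  obtain ⟨t₂, rfl⟩ := exists_param θ x₂ z e₂
  obtain ⟨t₃, rfl⟩ := exists_param θ x₃ z e₃
  have key : ∀ s : ℝ, z + s • dirv θ ∈ frontier C → s ≠ 0 := by
    rintro s hs rfl
    apply hs.2
    simpa using hz
  have pos : ∀ s t : ℝ, z + s • dirv θ ∈ frontier C → z + t • dirv θ ∈ frontier C →
      z + s • dirv θ ≠ z + t • dirv θ → 0 < s → 0 < t → False := by
    intro s t hs ht hne h0 h1
    exact hne (by rw [same_sign hC hz hs ht h0 h1])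
  have neg : ∀ s t : ℝ, z + s • dirv θ ∈ frontier C → z + t • dirv θ ∈ frontier C →
      z + s • dirv θ ≠ z + t • dirv θ → s < 0 → t < 0 → False := by
    intro s t hs ht hne h0 h1
    have := same_sign hC (v := -dirv θ) (s := -s) (t := -t) hz (by simpa using hs)
      (by simpa using ht) (by linarith) (by linarith)
    exact hne (by rw [neg_injective this])
  rcases lt_or_gt_of_ne (key _ h₁) with a | a <;> rcases lt_or_gt_of_ne (key _ h₂) with b | b <;>
    rcases lt_or_gt_of_ne (key _ h₃) with c | c
  all_goals first
    | exact neg _ _ h₁ h₂ h12 a b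
    | exact neg _ _ h₁ h₃ h13 a c
    | exact neg _ _ h₂ h₃ h23 b c
    | exact pos _ _ h₁ h₂ h12 a b
    | exact pos _ _ h₁ h₃ h13 a c
    | exact pos _ _ h₂ h₃ h23 b c

lemma ae_interior {C : Set Pt} (hC : Convex ℝ C) (hCi : (interior C).Nonempty) (θ : ℝ) :
    ∀ᵐ c : ℝ, c ∈ prj θ '' C → c ∈ prj θ '' interior C := by
  have hconv : Convex ℝ (prj θ '' interior C) :=
    hC.interior.is_linear_image (prj θ).isLinear
  have hnull := hconv.addHaar_frontier volume
  have hop : IsOpen (prj θ '' interior C) :=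
    (prj θ).isOpenMap_of_ne_zero (prj_ne_zero θ) _ isOpen_interior
  have := compl_mem_ae_iff.2 hnull
  filter_upwards [this] with c hc hcC
  by_contra hn
  apply hc
  rw [hop.frontier_eq]
  refine ⟨?_, hn⟩
  apply image_closure_subset_closure_image (prj θ).continuous
  rw [hC.closure_interior_eq_closure_of_nonempty_interior hCi]
  exact image_mono subset_closure hcC

/-- Pieces of the boundary: the sum of projections is at most twice the projection of `C`. -/
lemma sum_le_two {C : Set Pt} (hCc : IsCompact C) (hC : Convex ℝ C) (hCi : (interior C).Nonempty)
    (θ : ℝ) {n : ℕ} (B : Fin n → Set Pt) (hB : ∀ i, B i ⊆ frontier C)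
    (hd : ∀ i j, i ≠ j → Disjoint (B i) (B j)) (p q : Fin n → Pt)
    (hI : ∀ i, uIoo (prj θ (p i)) (prj θ (q i)) ⊆ prj θ '' B i) :
    ∑ i, ENNReal.ofReal |prj θ (q i - p i)| ≤ 2 * volume (prj θ '' C) := by
  classical
  have hfC : frontier C ⊆ C := hCc.isClosed.frontier_subset
  have hm : ∀ i, MeasurableSet (uIoo (prj θ (p i)) (prj θ (q i))) := fun i => measurableSet_Ioo
  have hmC : MeasurableSet (prj θ '' C) := (hCc.image (prj θ).continuous).measurableSet
  calc ∑ i, ENNReal.ofReal |prj θ (q i - p i)|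
      = ∑ i, ∫⁻ c, (uIoo (prj θ (p i)) (prj θ (q i))).indicator 1 c := by
        refine Finset.sum_congr rfl fun i _ => ?_
        rw [lintegral_indicator_one (hm i), Real.volume_uIoo, map_sub]
    _ = ∫⁻ c, ∑ i, (uIoo (prj θ (p i)) (prj θ (q i))).indicator 1 c := by
        rw [lintegral_finsetSum]
        intro i _
        exact measurable_one.indicator (hm i)
    _ ≤ ∫⁻ c, 2 * (prj θ '' C).indicator 1 c := by
        refine lintegral_mono_ae ?_
        filter_upwards [ae_interior hC hCi θ] with c hc
        by_cases hcC : c ∈ prj θ '' C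
        · obtain ⟨z, hz, rfl⟩ := hc hcC
          rw [indicator_of_mem hcC]
          simp only [indicator_apply, Pi.one_apply, Finset.sum_boole, mul_one]
          by_contra! hcon
          have h2 : 2 < (Finset.univ.filter fun i =>
              prj θ z ∈ uIoo (prj θ (p i)) (prj θ (q i))).card := by exact_mod_cast hcon
          obtain ⟨i, hi, j, hj, k, hk, hij, hik, hjk⟩ := Finset.two_lt_card.1 h2
          simp only [Finset.mem_filter, Finset.mem_univ, true_and] at hi hj hk
          obtain ⟨x, hx, ex⟩ := hI i hi
          obtain ⟨y, hy, ey⟩ := hI j hj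
          obtain ⟨w, hw, ew⟩ := hI k hk
          exact no_three hC θ hz (hB i hx) (hB j hy) (hB k hw) ex ey ew
            ((hd i j hij).ne_of_mem hx hy) ((hd i k hik).ne_of_mem hx hw)
            ((hd j k hjk).ne_of_mem hy hw)
        · rw [Finset.sum_eq_zero]
          · exact zero_le
          · intro i _
            apply indicator_of_notMem
            intro hi
            exact hcC (image_mono ((hB i).trans hfC) (hI i hi))
    _ = 2 * volume (prj θ '' C) := by
        rw [lintegral_const_mul _ (measurable_one.indicator hmC), lintegral_indicator_one hmC]

lemma barrier_proj {C : Set Pt} (a b : ℕ → Pt)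
    (hbar : IsBarrier (⋃ i, segment ℝ (a i) (b i)) C) (θ : ℝ) :
    volume (prj θ '' C) ≤ ∑' i, ENNReal.ofReal |prj θ (b i - a i)| := by
  have hsub : prj θ '' C ⊆ ⋃ i, uIcc (prj θ (a i)) (prj θ (b i)) := by
    rintro _ ⟨x, hx, rfl⟩
    obtain ⟨y, ⟨t, rfl⟩, hy⟩ := hbar {q : Pt | ∃ t : ℝ, q = x + t • dirv θ}
      ⟨x, dirv θ, dirv_ne_zero θ, rfl⟩ ⟨x, ⟨0, by simp⟩, hx⟩
    obtain ⟨i, hi⟩ := mem_iUnion.1 hy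
    refine mem_iUnion.2 ⟨i, ?_⟩
    have := mem_image_of_mem (prj θ) hi
    rw [prj_line] at this
    rw [← segment_eq_uIcc]
    have him := image_segment ℝ (prj θ).toLinearMap.toAffineMap (a i) (b i)
    exact him.subset this
  calc volume (prj θ '' C) ≤ _ := measure_mono hsub
    _ ≤ _ := measure_iUnion_le _
    _ = _ := by simp [Real.volume_interval]

/-- The constant `∫ |cos|`. -/
def cK : ENNReal := ∫⁻ θ in Ioc (-Real.pi) Real.pi, ENNReal.ofReal |Real.cos θ|

lemma cK_ne_top : cK ≠ ⊤ := by
  have : cK ≤ ∫⁻ θ in Ioc (-Real.pi) Real.pi, 1 := by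
    refine lintegral_mono fun θ => ?_
    simpa using Real.abs_cos_le_one θ
  refine ne_top_of_le_ne_top ?_ this
  simp

lemma cK_eq : cK = ENNReal.ofReal (∫ θ in (-Real.pi)..Real.pi, |Real.cos θ|) := by
  rw [intervalIntegral.integral_of_le (by linarith [Real.pi_pos]),
    ofReal_integral_eq_lintegral_ofReal]
  · rfl
  · exact (Continuous.intervalIntegrable (by fun_prop) _ _).1
  · exact Filter.Eventually.of_forall fun θ => abs_nonneg _

lemma cK_ne_zero : cK ≠ 0 := by
  rw [cK_eq]
  simp only [ne_eq, ENNReal.ofReal_eq_zero, not_le]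
  have hp := Real.pi_pos
  apply intervalIntegral.integral_pos (by linarith) (by fun_prop) (fun _ _ => abs_nonneg _)
  exact ⟨0, ⟨by linarith, hp.le⟩, by simp⟩

lemma lintegral_prj (v : Pt) :
    ∫⁻ θ in Ioc (-Real.pi) Real.pi, ENNReal.ofReal |prj θ v| = ENNReal.ofReal ‖v‖ * cK := by
  have hp := Real.pi_pos
  obtain ⟨φ, hφ⟩ : ∃ φ : ℝ, ∀ θ, prj θ v = ‖v‖ * Real.cos (θ - φ) := by
    refine ⟨Complex.arg ⟨v 0, v 1⟩, fun θ => ?_⟩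
    have hn : ‖v‖ = ‖(⟨v 0, v 1⟩ : ℂ)‖ := by
      rw [EuclideanSpace.norm_eq, Complex.norm_def, Complex.normSq_mk]
      simp [Fin.sum_univ_two, sq]
    rw [Real.cos_sub, hn, prj_apply]
    have h1 := Complex.norm_mul_cos_arg ⟨v 0, v 1⟩
    have h2 := Complex.norm_mul_sin_arg ⟨v 0, v 1⟩
    simp only at h1 h2
    linear_combination -Real.cos θ * h1 - Real.sin θ * h2
  simp_rw [hφ, abs_mul, abs_norm, ENNReal.ofReal_mul (norm_nonneg v)]
  rw [lintegral_const_mul _ (by fun_prop)]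
  congr 1
  rw [cK_eq, ← ofReal_integral_eq_lintegral_ofReal
    (Continuous.intervalIntegrable (by fun_prop) _ _).1
    (Filter.Eventually.of_forall fun θ => abs_nonneg _),
    ← intervalIntegral.integral_of_le (by linarith)]
  congr 1
  rw [intervalIntegral.integral_comp_sub_right (fun θ => |Real.cos θ|)]
  have hper : Function.Periodic (fun θ => |Real.cos θ|) (2 * Real.pi) := fun θ => by simp
  have := hper.intervalIntegral_add_eq (-Real.pi - φ) (-Real.pi)
  convert this using 2 <;> ring

lemma sum_norm_le {C : Set Pt} (hCc : IsCompact C) (hC : Convex ℝ C)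
    (hCi : (interior C).Nonempty) (a b : ℕ → Pt)
    (hbar : IsBarrier (⋃ i, segment ℝ (a i) (b i)) C)
    {n : ℕ} (B : Fin n → Set Pt) (hB : ∀ i, B i ⊆ frontier C)
    (hd : ∀ i j, i ≠ j → Disjoint (B i) (B j)) (p q : Fin n → Pt)
    (hI : ∀ θ i, uIoo (prj θ (p i)) (prj θ (q i)) ⊆ prj θ '' B i) :
    ∑ i, ENNReal.ofReal ‖q i - p i‖ ≤ 2 * ∑' i, ENNReal.ofReal ‖b i - a i‖ := by
  have hmeas : ∀ v : Pt, Measurable fun θ => ENNReal.ofReal |prj θ v| := by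
    intro v
    simp_rw [prj_apply]
    fun_prop
  have key : ∫⁻ θ in Ioc (-Real.pi) Real.pi, ∑ i, ENNReal.ofReal |prj θ (q i - p i)| ≤
      ∫⁻ θ in Ioc (-Real.pi) Real.pi, 2 * ∑' i, ENNReal.ofReal |prj θ (b i - a i)| :=
    lintegral_mono fun θ => (sum_le_two hCc hC hCi θ B hB hd p q (hI θ)).trans
      (mul_le_mul_right (barrier_proj a b hbar θ) 2)
  rw [lintegral_finsetSum _ (fun i _ => hmeas _), lintegral_const_mul _
    (Measurable.tsum fun i => hmeas _), lintegral_tsum (fun i => (hmeas _).aemeasurable)] at key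
  simp_rw [lintegral_prj] at key
  rw [← Finset.sum_mul, ENNReal.tsum_mul_right, ← mul_assoc] at key
  exact (ENNReal.mul_le_mul_iff_left cK_ne_zero cK_ne_top).1 key

/-- Unit circle. -/
def circ (t : ℝ) : Pt := !₂[Real.cos t, Real.sin t]

lemma circ_cont : Continuous circ := by
  unfold circ
  fun_prop

lemma circ_mem (t : ℝ) : circ t ∈ Metric.sphere (0 : Pt) 1 := by
  simp [circ, EuclideanSpace.norm_eq, Fin.sum_univ_two]

lemma circ_surj {x : Pt} (hx : x ∈ Metric.sphere (0 : Pt) 1) :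
    ∃ t ∈ Ioc (-Real.pi) Real.pi, circ t = x := by
  refine ⟨Complex.arg ⟨x 0, x 1⟩, Complex.arg_mem_Ioc _, ?_⟩
  have hn : ‖x‖ = ‖(⟨x 0, x 1⟩ : ℂ)‖ := by
    rw [EuclideanSpace.norm_eq, Complex.norm_def, Complex.normSq_mk]
    simp [Fin.sum_univ_two, sq]
  have h1 := Complex.norm_mul_cos_arg ⟨x 0, x 1⟩
  have h2 := Complex.norm_mul_sin_arg ⟨x 0, x 1⟩
  have hx1 : ‖x‖ = 1 := by simpa using hx
  rw [← hn, hx1, one_mul] at h1 h2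
  ext i
  fin_cases i
  · simpa [circ] using h1
  · simpa [circ] using h2

lemma circ_inj {s t : ℝ} (hs : s ∈ Ioc (-Real.pi) Real.pi) (ht : t ∈ Ioc (-Real.pi) Real.pi)
    (h : circ s = circ t) : s = t := by
  have h0 := congrArg (fun x : Pt => x 0) h
  have h1 := congrArg (fun x : Pt => x 1) h
  simp [circ] at h0 h1
  have := Real.Angle.cos_sin_inj h0 h1
  rw [← Real.Angle.toReal_coe_eq_self_iff_mem_Ioc] at hs ht
  rw [← hs, ← ht, this]

/-- Partition points. -/
def tp (n i : ℕ) : ℝ := -Real.pi + 2 * Real.pi * i / (n + 1)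

lemma tp_mono (n : ℕ) : Monotone (tp n) := by
  intro i j h
  have := Real.pi_pos
  have : (i : ℝ) ≤ j := by exact_mod_cast h
  unfold tp
  gcongr

lemma tp_zero (n : ℕ) : tp n 0 = -Real.pi := by simp [tp]

lemma tp_last (n : ℕ) : tp n (n + 1) = Real.pi := by
  unfold tp; push_cast; field_simp; ring

lemma tp_succ (n i : ℕ) : tp n (i + 1) - tp n i = 2 * Real.pi / (n + 1) := by
  unfold tp; push_cast; ring

lemma tp_cover (n : ℕ) {t : ℝ} (ht : t ∈ Ioc (-Real.pi) Real.pi) :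
    ∃ i : Fin (n + 1), t ∈ Icc (tp n i) (tp n (i + 1)) := by
  have h : ∀ m, m ≤ n + 1 → t ≤ tp n m → ∃ i < m, t ∈ Icc (tp n i) (tp n (i + 1)) := by
    intro m
    induction m with
    | zero => intro _ h; rw [tp_zero] at h; exact absurd ht.1 (not_lt.2 h)
    | succ k ih =>
      intro hk h
      by_cases h2 : t ≤ tp n k
      · obtain ⟨i, hi, h3⟩ := ih (by omega) h2
        exact ⟨i, by omega, h3⟩
      · exact ⟨k, by omega, (not_le.1 h2).le, h⟩
  obtain ⟨i, hi, h3⟩ := h (n + 1) le_rfl (by rw [tp_last]; exact ht.2)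
  exact ⟨⟨i, hi⟩, h3⟩

lemma tp_sub (n : ℕ) (i : Fin (n + 1)) :
    Ioo (tp n i) (tp n (i + 1)) ⊆ Ioc (-Real.pi) Real.pi := by
  intro t ht
  refine ⟨?_, ?_⟩
  · rw [← tp_zero n]; exact (tp_mono n (Nat.zero_le _)).trans_lt ht.1
  · rw [← tp_last n]; exact ht.2.le.trans (tp_mono n (by omega))

lemma tp_sub' (n : ℕ) (i : Fin (n + 1)) :
    Icc (tp n i) (tp n (i + 1)) ⊆ Icc (-Real.pi) Real.pi := by
  intro t ht
  refine ⟨?_, ?_⟩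
  · rw [← tp_zero n]; exact (tp_mono n (Nat.zero_le _)).trans ht.1
  · rw [← tp_last n]; exact ht.2.trans (tp_mono n (by omega))

lemma tp_disj (n : ℕ) {i j : ℕ} (h : i ≠ j) :
    Disjoint (Ioo (tp n i) (tp n (i + 1))) (Ioo (tp n j) (tp n (j + 1))) := by
  rw [Set.disjoint_left]
  rintro t ⟨h1, h2⟩ ⟨h3, h4⟩
  rcases lt_or_gt_of_ne h with h | h
  · have := tp_mono n (show i + 1 ≤ j by omega)
    linarith
  · have := tp_mono n (show j + 1 ≤ i by omega)
    linarith

lemma ivt_uIoo {g : ℝ → ℝ} (hg : Continuous g) {l r s t : ℝ} (hs : s ∈ Icc l r)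
    (ht : t ∈ Icc l r) : uIoo (g s) (g t) ⊆ g '' Ioo l r := by
  rcases le_total s t with h | h
  · rcases le_total (g s) (g t) with h' | h'
    · rw [uIoo_of_le h']
      exact (intermediate_value_Ioo h hg.continuousOn).trans
        (image_mono (Ioo_subset_Ioo hs.1 ht.2))
    · rw [uIoo_of_ge h']
      exact (intermediate_value_Ioo' h hg.continuousOn).trans
        (image_mono (Ioo_subset_Ioo hs.1 ht.2))
  · rcases le_total (g s) (g t) with h' | h'
    · rw [uIoo_of_le h']
      exact (intermediate_value_Ioo' h hg.continuousOn).trans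
        (image_mono (Ioo_subset_Ioo ht.1 hs.2))
    · rw [uIoo_of_ge h']
      exact (intermediate_value_Ioo h hg.continuousOn).trans
        (image_mono (Ioo_subset_Ioo ht.1 hs.2))

lemma exists_ediam {A : Set Pt} (hA : IsCompact A) (hne : A.Nonempty) :
    ∃ p ∈ A, ∃ q ∈ A, Metric.ediam A ≤ ENNReal.ofReal ‖q - p‖ := by
  have hc : Continuous fun x : Pt × Pt => ‖x.2 - x.1‖ :=
    (continuous_snd.sub continuous_fst).norm
  obtain ⟨w, hw, h⟩ := (hA.prod hA).exists_isMaxOn (hne.prod hne) hc.continuousOn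
  have h' : ∀ x ∈ A, ∀ y ∈ A, ‖y - x‖ ≤ ‖w.2 - w.1‖ := fun x hx y hy =>
    isMaxOn_iff.1 h (x, y) (Set.mk_mem_prod hx hy)
  refine ⟨w.1, hw.1, w.2, hw.2, Metric.ediam_le fun x hx y hy => ?_⟩
  rw [edist_dist, dist_comm, dist_eq_norm]
  exact ENNReal.ofReal_le_ofReal (h' x hx y hy)

lemma hausdorff_le {C : Set Pt} (hCc : IsCompact C) (hC : Convex ℝ C)
    (hCi : (interior C).Nonempty) (a b : ℕ → Pt)
    (hbar : IsBarrier (⋃ i, segment ℝ (a i) (b i)) C) :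
    μH[1] (frontier C) ≤ 2 * ∑' i, ENNReal.ofReal ‖b i - a i‖ := by
  obtain ⟨e, -, -, he⟩ :=
    exists_homeomorph_image_interior_closure_frontier_eq_unitBall hC hCi hCc.isBounded
  set γ : ℝ → Pt := fun t => e.symm (circ t) with hγ
  have hγc : Continuous γ := e.symm.continuous.comp circ_cont
  have hγm : ∀ t, γ t ∈ frontier C := by
    intro t
    have := circ_mem t
    rw [← he] at this
    obtain ⟨x, hx, hxe⟩ := this
    simpa [hγ, ← hxe] using hx
  have hγs : ∀ x ∈ frontier C, ∃ t ∈ Ioc (-Real.pi) Real.pi, γ t = x := by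
    intro x hx
    obtain ⟨t, ht, h⟩ := circ_surj (he ▸ mem_image_of_mem e hx)
    exact ⟨t, ht, by simp [hγ, h]⟩
  have hγi : ∀ s ∈ Ioc (-Real.pi) Real.pi, ∀ t ∈ Ioc (-Real.pi) Real.pi, γ s = γ t → s = t :=
    fun s hs t ht h => circ_inj hs ht (e.symm.injective h)
  let A : (n : ℕ) → Fin (n + 1) → Set Pt := fun n i => γ '' Icc (tp n i) (tp n (i + 1))
  let r : ℕ → ENNReal := fun n => ⨆ i, Metric.ediam (A n i)
  have hr : Filter.Tendsto r Filter.atTop (nhds 0) := by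
    rw [ENNReal.tendsto_nhds_zero]
    intro ε hε
    have huc := (isCompact_Icc (a := -Real.pi) (b := Real.pi)).uniformContinuousOn_of_continuous
      hγc.continuousOn
    rw [EMetric.uniformContinuousOn_iff] at huc
    obtain ⟨δ, hδ, H⟩ := huc ε hε
    have hlim : Filter.Tendsto (fun n : ℕ => ENNReal.ofReal (2 * Real.pi / (n + 1)))
        Filter.atTop (nhds 0) := by
      rw [← ENNReal.ofReal_zero]
      refine ENNReal.tendsto_ofReal ?_
      have := (tendsto_one_div_add_atTop_nhds_zero_nat (𝕜 := ℝ)).const_mul (2 * Real.pi)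
      simpa [div_eq_mul_inv] using this
    filter_upwards [hlim.eventually_lt_const hδ] with n hn
    refine iSup_le fun i => Metric.ediam_image_le_iff.2 fun x hx y hy => ?_
    refine (H (tp_sub' n i hx) (tp_sub' n i hy) (lt_of_le_of_lt ?_ hn)).le
    rw [edist_dist, Real.dist_eq]
    refine ENNReal.ofReal_le_ofReal ?_
    rw [← tp_succ n i, abs_le]
    exact ⟨by linarith [hx.1, hy.2], by linarith [hx.2, hy.1]⟩
  refine (Measure.hausdorffMeasure_le_liminf_sum 1 (frontier C) r hr A
    (Filter.Eventually.of_forall fun n i => le_iSup (fun i => Metric.ediam (A n i)) i)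
    (Filter.Eventually.of_forall fun n x hx => ?_)).trans ?_
  · obtain ⟨t, ht, rfl⟩ := hγs x hx
    obtain ⟨i, hi⟩ := tp_cover n ht
    exact mem_iUnion.2 ⟨i, mem_image_of_mem _ hi⟩
  · refine Filter.liminf_le_of_le (by isBoundedDefault) fun K hK => ?_
    obtain ⟨n, hn⟩ := hK.exists
    refine hn.trans ?_
    simp only [ENNReal.rpow_one]
    have hex : ∀ i : Fin (n + 1), ∃ s ∈ Icc (tp n i) (tp n (i + 1)),
        ∃ t ∈ Icc (tp n i) (tp n (i + 1)),
        Metric.ediam (A n i) ≤ ENNReal.ofReal ‖γ t - γ s‖ := by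
      intro i
      obtain ⟨_, ⟨s, hs, rfl⟩, _, ⟨t, ht, rfl⟩, h⟩ := exists_ediam (A := A n i)
        (isCompact_Icc.image hγc)
        ((nonempty_Icc.2 (tp_mono n (Nat.le_succ i))).image γ)
      exact ⟨s, hs, t, ht, h⟩
    choose s hs t ht hst using hex
    refine (Finset.sum_le_sum fun i _ => hst i).trans ?_
    refine sum_norm_le hCc hC hCi a b hbar (fun i => γ '' Ioo (tp n i) (tp n (i + 1)))
      ?_ ?_ _ _ ?_
    · rintro i _ ⟨u, -, rfl⟩
      exact hγm u
    · intro i j hij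
      rw [Set.disjoint_left]
      rintro _ ⟨u, hu, rfl⟩ ⟨w, hw, h⟩
      have := hγi w (tp_sub n j hw) u (tp_sub n i hu) h
      subst this
      exact Set.disjoint_left.1 (tp_disj n (fun h => hij (Fin.ext h))) hu hw
    · intro θ i
      rw [image_image]
      exact ivt_uIoo (g := fun x => prj θ (γ x)) ((prj θ).continuous.comp hγc) (hs i) (ht i)

/-- any segment barrier for a convex body C has total length at least
half the perimeter of C (the 1-dimensional Hausdorff measure of its boundary). -/
theorem segment_barrier_length_ge_half_perimeter
    (C : Set Pt) (hCcomp : IsCompact C) (hCconv : Convex ℝ C)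
    (hCint : (interior C).Nonempty)
    (a b : ℕ → Pt) (hab : ∀ i, a i ≠ b i)
    (hbar : IsBarrier (⋃ i, segment ℝ (a i) (b i)) C)
    (hsum : Summable fun i => ‖b i - a i‖) :
    (μH[1] (frontier C)).toReal / 2 ≤ ∑' i, ‖b i - a i‖ := by
  have h := hausdorff_le hCcomp hCconv hCint a b hbar
  rw [← ENNReal.ofReal_tsum_of_nonneg (fun i => norm_nonneg _) hsum] at h
  have h2 := ENNReal.toReal_mono (by finiteness) h
  rw [ENNReal.toReal_mul, ENNReal.toReal_ofReal (tsum_nonneg fun i => norm_nonneg _)] at h2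
  simp at h2
  linarith
end
end

section
/- Let U = [0,1] × [0,1] be the unit square, let U₂ = [−10⁻³, 1 + 10⁻³] × [−10⁻³, 1 + 10⁻³], and let s = [a, b] (a ≠ b) be a closed segment disjoint from U₂. Then the measure of all lines that meet both s and U is at most (1/4 + 10⁻⁶)^{−1/2} · ‖b − a‖, which is strictly less than 2 · ‖b − a‖; that is, the 2-dimensional Lebesgue measure of {(α, p) ∈ [0, π) × ℝ : ℓ(α, p) ∩ U ≠ ∅ and ℓ(α, p) ∩ s ≠ ∅} is at most (1/4 + 10⁻⁶)^{−1/2} · ‖b − a‖. -/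
open MeasureTheory Set

noncomputable section

/-- The enlarged square U₂ = [−10⁻³, 1 + 10⁻³]². -/
def U2 : Set Pt :=
  {p : Pt | p 0 ∈ Icc (-(10:ℝ) ^ (-3 : ℤ)) (1 + 10 ^ (-3 : ℤ)) ∧
            p 1 ∈ Icc (-(10:ℝ) ^ (-3 : ℤ)) (1 + 10 ^ (-3 : ℤ))}

/-- The line ℓ(α, p) = {(x, y) : x cos α + y sin α = p}. -/
def paramLine (α p : ℝ) : Set Pt :=
  {q : Pt | q 0 * Real.cos α + q 1 * Real.sin α = p}

/-- The set of parameters (α, p) ∈ [0, π) × ℝ of lines that meet both sets A and B. -/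
def linesMeetingBoth (A B : Set Pt) : Set (ℝ × ℝ) :=
  {αp : ℝ × ℝ | αp.1 ∈ Ico 0 Real.pi ∧ (paramLine αp.1 αp.2 ∩ A).Nonempty ∧
    (paramLine αp.1 αp.2 ∩ B).Nonempty}


lemma arctan_add_le' {X Y : ℝ} (hX : 0 ≤ X) (hY : 0 ≤ Y) :
    Real.arctan X + Real.arctan Y ≤ 2 * Real.arctan ((X + Y) / 2) := by
  set u := Real.arctan X with hu
  set v := Real.arctan Y with hv
  have hu0 : 0 ≤ u := Real.arctan_nonneg.2 hX
  have hv0 : 0 ≤ v := Real.arctan_nonneg.2 hY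
  have hu1 : u < Real.pi / 2 := Real.arctan_lt_pi_div_two X
  have hv1 : v < Real.pi / 2 := Real.arctan_lt_pi_div_two Y
  have hXu : X = Real.tan u := (Real.tan_arctan X).symm
  have hYv : Y = Real.tan v := (Real.tan_arctan Y).symm
  have hcu : 0 < Real.cos u := Real.cos_arctan_pos X
  have hcv : 0 < Real.cos v := Real.cos_arctan_pos Y
  have key : Real.tan ((u + v) / 2) ≤ (X + Y) / 2 := by
    set w := (u + v) / 2 with hw
    have hcw : 0 < Real.cos w := Real.cos_pos_of_mem_Ioo ⟨by linarith, by linarith⟩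
    have hsw : 0 ≤ Real.sin w := Real.sin_nonneg_of_nonneg_of_le_pi (by linarith) (by linarith)
    set e := (u - v) / 2 with he
    have h1 : u = w + e := by rw [hw, he]; ring
    have h2 : v = w - e := by rw [hw, he]; ring
    have h3 : Real.tan u + Real.tan v = 2 * Real.sin w * Real.cos w / (Real.cos u * Real.cos v) := by
      rw [Real.tan_eq_sin_div_cos, Real.tan_eq_sin_div_cos]
      field_simp
      rw [h1, h2, Real.sin_add, Real.cos_add, Real.sin_sub, Real.cos_sub]
      linear_combination (2 * Real.sin w * Real.cos w) * (Real.sin_sq_add_cos_sq e)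
    have h4 : Real.cos u * Real.cos v ≤ Real.cos w ^ 2 := by
      rw [h1, h2, Real.cos_add, Real.cos_sub]
      nlinarith [Real.sin_sq_add_cos_sq e, Real.sin_sq_add_cos_sq w, sq_nonneg (Real.sin e)]
    rw [hXu, hYv, h3, Real.tan_eq_sin_div_cos, le_div_iff₀ (by norm_num), le_div_iff₀ (by positivity)]
    rw [div_mul_eq_mul_div, div_mul_eq_mul_div, div_le_iff₀ hcw]
    nlinarith
  have := Real.arctan_mono key
  rw [Real.arctan_tan (by linarith) (by linarith)] at this
  linarith

lemma angle_range (m h : ℝ) (hh : 1/1000 ≤ h) : ∃ A B : ℝ, B - A ≤ 2 * Real.arctan 500 ∧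
    ∀ q ∈ Icc (0:ℝ) 1, ∀ w ∈ Icc (0:ℝ) 1, Real.arctan ((q - m) / (w + h)) ∈ Icc A B := by
  have hp : Real.pi / 2 ≤ 2 * Real.arctan 500 := by
    have : Real.arctan 1 ≤ Real.arctan 500 := Real.arctan_mono (by norm_num)
    rw [Real.arctan_one] at this
    linarith
  rcases lt_or_ge m 0 with hm | hm
  · refine ⟨0, Real.pi / 2, by linarith, fun q hq w hw => ⟨?_, (Real.arctan_lt_pi_div_two _).le⟩⟩
    exact Real.arctan_nonneg.2 (div_nonneg (by linarith [hq.1]) (by linarith [hw.1]))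
  rcases lt_or_ge 1 m with hm' | hm'
  · refine ⟨-(Real.pi / 2), 0, by linarith, fun q hq w hw => ⟨(Real.neg_pi_div_two_lt_arctan _).le, ?_⟩⟩
    rw [← Real.arctan_zero]
    exact Real.arctan_mono (div_nonpos_of_nonpos_of_nonneg (by linarith [hq.2]) (by linarith [hw.1]))
  · refine ⟨Real.arctan (-(1000 * m)), Real.arctan (1000 * (1 - m)), ?_, fun q hq w hw => ⟨?_, ?_⟩⟩
    · rw [Real.arctan_neg]
      have := arctan_add_le' (X := 1000 * m) (Y := 1000 * (1 - m)) (by linarith) (by linarith)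
      rw [show (1000 * m + 1000 * (1 - m)) / 2 = 500 by ring] at this
      linarith
    · apply Real.arctan_mono
      rw [le_div_iff₀ (by linarith [hw.1])]
      nlinarith [hw.1, hq.1]
    · apply Real.arctan_mono
      rw [div_le_iff₀ (by linarith [hw.1])]
      nlinarith [hw.1, hq.2]

lemma mod_pi (β r : ℝ) (h : Real.sin β = r * Real.cos β) :
    ∃ k : ℤ, β + k * Real.pi = Real.arctan r := by
  have : Real.sin (Real.arctan r - β) = 0 := by
    rw [Real.sin_sub, h]
    have h1 : Real.sin (Real.arctan r) = r * Real.cos (Real.arctan r) := by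
      have := Real.tan_arctan r
      rw [Real.tan_eq_sin_div_cos, div_eq_iff (Real.cos_arctan_pos r).ne'] at this
      exact this
    rw [h1]; ring
  obtain ⟨k, hk⟩ := Real.sin_eq_zero_iff.1 this
  exact ⟨k, by rw [hk]; ring⟩

lemma vol_mod_pi (S : Set ℝ) (hS : S ⊆ Ico 0 Real.pi) (A B : ℝ)
    (h : ∀ α ∈ S, ∃ k : ℤ, α + k * Real.pi ∈ Icc A B) : volume S ≤ ENNReal.ofReal (B - A) := by
  have hsub : S ⊆ ⋃ k : ℤ, (fun α : ℝ => α + k * Real.pi) ⁻¹'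
      (Icc A B ∩ Ico (k * Real.pi) ((k + 1) * Real.pi)) := by
    intro α hα
    obtain ⟨k, hk⟩ := h α hα
    have := hS hα
    refine mem_iUnion.2 ⟨k, hk, ?_, ?_⟩
    · simpa using this.1
    · have := this.2
      simp only
      linarith
  calc volume S ≤ ∑' k : ℤ, volume ((fun α : ℝ => α + k * Real.pi) ⁻¹'
      (Icc A B ∩ Ico (k * Real.pi) ((k + 1) * Real.pi))) := (measure_mono hsub).trans (measure_iUnion_le _)
    _ = ∑' k : ℤ, volume (Icc A B ∩ Ico (k * Real.pi) ((k + 1) * Real.pi)) := by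
      congr 1; ext k; exact measure_preimage_add_right _ _ _
    _ = volume (⋃ k : ℤ, (Icc A B ∩ Ico (k * Real.pi) ((k + 1) * Real.pi))) := by
      rw [measure_iUnion]
      · intro i j hij
        refine Disjoint.mono inter_subset_right inter_subset_right ?_
        rw [Set.disjoint_left]
        rintro x ⟨h1, h2⟩ ⟨h3, h4⟩
        have hpi := Real.pi_pos
        have a1 : (i : ℝ) < j + 1 := lt_of_mul_lt_mul_right (h1.trans_lt h4) hpi.le
        have a2 : (j : ℝ) < i + 1 := lt_of_mul_lt_mul_right (h3.trans_lt h2) hpi.le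
        norm_cast at a1 a2
        omega
      · intro k; exact measurableSet_Icc.inter measurableSet_Ico
    _ ≤ volume (Icc A B) := measure_mono (iUnion_subset fun k => inter_subset_left)
    _ = _ := Real.volume_Icc

def angSet (x y : ℝ) : Set ℝ := {α | α ∈ Ico 0 Real.pi ∧ ∃ q ∈ Icc (0:ℝ) 1 ×ˢ Icc (0:ℝ) 1,
  (q.1 - x) * Real.cos α + (q.2 - y) * Real.sin α = 0}

lemma vol_angSet (x y : ℝ) (h : x < -(1/1000) ∨ 1 + 1/1000 < x ∨ y < -(1/1000) ∨ 1 + 1/1000 < y) :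
    volume (angSet x y) ≤ ENNReal.ofReal (2 * Real.arctan 500) := by
  have fin : ∀ A B : ℝ, B - A ≤ 2 * Real.arctan 500 →
      (∀ α ∈ angSet x y, ∃ k : ℤ, α + k * Real.pi ∈ Icc A B) →
      volume (angSet x y) ≤ ENNReal.ofReal (2 * Real.arctan 500) := fun A B h1 h2 =>
    (vol_mod_pi _ (fun α h => h.1) A B h2).trans (ENNReal.ofReal_le_ofReal h1)
  rcases h with h | h | h | h
  · obtain ⟨A, B, hAB, H⟩ := angle_range y (-x) (by linarith)
    refine fin (A + Real.pi / 2) (B + Real.pi / 2) (by linarith) ?_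
    rintro α ⟨hα, q, ⟨hq1, hq2⟩, e⟩
    have := H q.2 hq2 q.1 hq1
    have hpos : q.1 + -x ≠ 0 := by have := hq1.1; intro h'; linarith
    obtain ⟨k, hk⟩ := mod_pi (α - Real.pi / 2) ((q.2 - y) / (q.1 + -x)) (by
      rw [Real.sin_sub_pi_div_two, Real.cos_sub_pi_div_two]; field_simp; linarith)
    rw [← hk] at this
    exact ⟨k, by linarith [this.1], by linarith [this.2]⟩
  · obtain ⟨A, B, hAB, H⟩ := angle_range y (x - 1) (by linarith)
    refine fin (-B + Real.pi / 2) (-A + Real.pi / 2) (by linarith) ?_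
    rintro α ⟨hα, q, ⟨hq1, hq2⟩, e⟩
    have := H q.2 hq2 (1 - q.1) ⟨by linarith [hq1.2], by linarith [hq1.1]⟩
    have hpos : 1 - q.1 + (x - 1) ≠ 0 := by have := hq1.2; intro h'; linarith
    obtain ⟨k, hk⟩ := mod_pi (α - Real.pi / 2) (-((q.2 - y) / (1 - q.1 + (x - 1)))) (by
      rw [Real.sin_sub_pi_div_two, Real.cos_sub_pi_div_two]; field_simp; linarith)
    rw [Real.arctan_neg] at hk
    exact ⟨k, by linarith [this.2], by linarith [this.1]⟩
  · obtain ⟨A, B, hAB, H⟩ := angle_range x (-y) (by linarith)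
    refine fin (-B) (-A) (by linarith) ?_
    rintro α ⟨hα, q, ⟨hq1, hq2⟩, e⟩
    have := H q.1 hq1 q.2 hq2
    have hpos : q.2 + -y ≠ 0 := by have := hq2.1; intro h'; linarith
    obtain ⟨k, hk⟩ := mod_pi α (-((q.1 - x) / (q.2 + -y))) (by
      field_simp; linarith)
    rw [Real.arctan_neg] at hk
    exact ⟨k, by linarith [this.2], by linarith [this.1]⟩
  · obtain ⟨A, B, hAB, H⟩ := angle_range x (y - 1) (by linarith)
    refine fin A B (by linarith) ?_
    rintro α ⟨hα, q, ⟨hq1, hq2⟩, e⟩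
    have := H q.1 hq1 (1 - q.2) ⟨by linarith [hq2.2], by linarith [hq2.1]⟩
    have hpos : 1 - q.2 + (y - 1) ≠ 0 := by have := hq2.2; intro h'; linarith
    obtain ⟨k, hk⟩ := mod_pi α (((q.1 - x) / (1 - q.2 + (y - 1)))) (by
      field_simp; linarith)
    exact ⟨k, by linarith [this.1], by linarith [this.2]⟩

lemma integral_bathtub (φ : ℝ) (h0 : 0 ≤ φ) (h1 : φ ≤ Real.pi / 2) (ψ : ℝ) :
    ∫ α in (0:ℝ)..Real.pi, max (|Real.cos (α - ψ)| - Real.cos φ) 0 =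
      2 * Real.sin φ - 2 * φ * Real.cos φ := by
  set G : ℝ → ℝ := fun α => max (|Real.cos α| - Real.cos φ) 0 with hG
  have hcont : Continuous G := by fun_prop
  have hper : Function.Periodic G Real.pi := by
    intro x
    simp [hG, Real.cos_add_pi]
  have e1 : ∫ α in (0:ℝ)..Real.pi, max (|Real.cos (α - ψ)| - Real.cos φ) 0 =
      ∫ α in (0 - ψ)..(Real.pi - ψ), G α :=
    intervalIntegral.integral_comp_sub_right G ψ
  have e2 := hper.intervalIntegral_add_eq (0 - ψ) (-(Real.pi / 2))
  rw [show 0 - ψ + Real.pi = Real.pi - ψ by ring,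
    show -(Real.pi / 2) + Real.pi = Real.pi / 2 by ring] at e2
  have hi : ∀ a b : ℝ, IntervalIntegrable G volume a b := fun a b => hcont.intervalIntegrable a b
  rw [e1, e2, ← intervalIntegral.integral_add_adjacent_intervals (hi _ (-φ)) (hi (-φ) _),
    ← intervalIntegral.integral_add_adjacent_intervals (hi (-φ) φ) (hi φ _)]
  have hpi := Real.pi_pos
  have i1 : ∫ α in (-(Real.pi / 2))..(-φ), G α = 0 := by
    rw [intervalIntegral.integral_congr (g := fun _ => (0:ℝ))]
    · simp
    · intro x hx
      rw [uIcc_of_le (by linarith)] at hx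
      simp only [hG]
      apply max_eq_right
      rw [abs_of_nonneg (Real.cos_nonneg_of_mem_Icc ⟨by linarith [hx.1], by linarith [hx.2]⟩),
        ← Real.cos_neg x]
      have := Real.cos_le_cos_of_nonneg_of_le_pi (x := φ) (y := -x) h0 (by linarith [hx.1]) (by linarith [hx.2])
      linarith
  have i3 : ∫ α in φ..(Real.pi / 2), G α = 0 := by
    rw [intervalIntegral.integral_congr (g := fun _ => (0:ℝ))]
    · simp
    · intro x hx
      rw [uIcc_of_le (by linarith)] at hx
      simp only [hG]
      apply max_eq_right
      rw [abs_of_nonneg (Real.cos_nonneg_of_mem_Icc ⟨by linarith [hx.1], by linarith [hx.2]⟩)]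
      have := Real.cos_le_cos_of_nonneg_of_le_pi (x := φ) (y := x) h0 (by linarith [hx.2]) (by linarith [hx.1])
      linarith
  have i2 : ∫ α in (-φ)..φ, G α = 2 * Real.sin φ - 2 * φ * Real.cos φ := by
    rw [intervalIntegral.integral_congr (g := fun x => Real.cos x - Real.cos φ)]
    · rw [intervalIntegral.integral_sub (Real.continuous_cos.intervalIntegrable _ _) (by simp)]
      simp
      ring
    · intro x hx
      rw [uIcc_of_le (by linarith)] at hx
      simp only [hG]
      rw [abs_of_nonneg (Real.cos_nonneg_of_mem_Icc ⟨by linarith [hx.1], by linarith [hx.2]⟩)]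
      apply max_eq_left
      have := Real.cos_le_cos_of_nonneg_of_le_pi (x := |x|) (y := φ) (abs_nonneg _) (by linarith) (abs_le.2 hx)
      rw [Real.cos_abs] at this
      linarith
  rw [i1, i2, i3]; ring

lemma lintegral_bathtub (φ : ℝ) (h0 : 0 ≤ φ) (h1 : φ ≤ Real.pi / 2) (v w : ℝ) (S : Set ℝ)
    (hS : S ⊆ Ico 0 Real.pi) (hv : volume S ≤ ENNReal.ofReal (2 * φ)) :
    ∫⁻ α in S, ENNReal.ofReal |v * Real.cos α + w * Real.sin α| ≤
      ENNReal.ofReal (2 * Real.sin φ * √(v ^ 2 + w ^ 2)) := by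
  obtain ⟨ψ, hψ⟩ : ∃ ψ, ∀ α, v * Real.cos α + w * Real.sin α = √(v ^ 2 + w ^ 2) * Real.cos (α - ψ) := by
    have hn : ‖(⟨v, w⟩ : ℂ)‖ = √(v ^ 2 + w ^ 2) := by
      rw [Complex.norm_def, Complex.normSq_mk]; ring_nf
    refine ⟨Complex.arg ⟨v, w⟩, fun α => ?_⟩
    have a1 := Complex.norm_mul_cos_arg ⟨v, w⟩
    have a2 := Complex.norm_mul_sin_arg ⟨v, w⟩
    rw [hn] at a1 a2
    simp only at a1 a2
    rw [Real.cos_sub]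
    linear_combination (-Real.cos α) * a1 - Real.sin α * a2
  set ρ := √(v ^ 2 + w ^ 2)
  have hρ : 0 ≤ ρ := Real.sqrt_nonneg _
  have hc : 0 ≤ Real.cos φ := Real.cos_nonneg_of_mem_Icc ⟨by linarith, h1⟩
  have hcont : Continuous fun α => max (|Real.cos (α - ψ)| - Real.cos φ) 0 := by fun_prop
  have hI : ∫⁻ α in S, ENNReal.ofReal |Real.cos (α - ψ)| ≤ ENNReal.ofReal (2 * Real.sin φ) := by
    calc ∫⁻ α in S, ENNReal.ofReal |Real.cos (α - ψ)|
        ≤ ∫⁻ α in S, (ENNReal.ofReal (max (|Real.cos (α - ψ)| - Real.cos φ) 0)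
            + ENNReal.ofReal (Real.cos φ)) := by
          apply lintegral_mono
          intro α
          simp only
          rw [← ENNReal.ofReal_add (le_max_right _ _) hc]
          apply ENNReal.ofReal_le_ofReal
          linarith [le_max_left (|Real.cos (α - ψ)| - Real.cos φ) 0]
      _ = (∫⁻ α in S, (ENNReal.ofReal (max (|Real.cos (α - ψ)| - Real.cos φ) 0)))
            + ENNReal.ofReal (Real.cos φ) * volume S := by
          rw [lintegral_add_right _ measurable_const]
          simp
      _ ≤ (∫⁻ α in Ioc 0 Real.pi, (ENNReal.ofReal (max (|Real.cos (α - ψ)| - Real.cos φ) 0)))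
            + ENNReal.ofReal (Real.cos φ) * ENNReal.ofReal (2 * φ) := by
          rw [← restrict_Ico_eq_restrict_Ioc]
          exact add_le_add (lintegral_mono_set hS) (by gcongr)
      _ = ENNReal.ofReal (2 * Real.sin φ - 2 * φ * Real.cos φ) + ENNReal.ofReal (Real.cos φ * (2 * φ)) := by
          rw [ENNReal.ofReal_mul hc, ← integral_bathtub φ h0 h1 ψ,
            intervalIntegral.integral_of_le Real.pi_pos.le, ofReal_integral_eq_lintegral_ofReal]
          · exact hcont.integrableOn_Ioc
          · exact Filter.Eventually.of_forall fun x => le_max_right _ _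
      _ = _ := by
          rw [← ENNReal.ofReal_add]
          · congr 1; ring
          · rw [← integral_bathtub φ h0 h1 ψ]
            exact intervalIntegral.integral_nonneg Real.pi_pos.le fun x _ => le_max_right _ _
          · positivity
  simp_rw [hψ, abs_mul, abs_of_nonneg hρ, ENNReal.ofReal_mul hρ]
  rw [lintegral_const_mul' _ _ ENNReal.ofReal_ne_top, mul_comm (2 * Real.sin φ), ENNReal.ofReal_mul hρ]
  gcongr

def parSet (a0 a1 v w : ℝ) : Set (ℝ × ℝ) :=
  {z | z.1 ∈ Ico 0 Real.pi ∧ z.2 ∈ Icc (0:ℝ) 1 ∧ ∃ q ∈ Icc (0:ℝ) 1 ×ˢ Icc (0:ℝ) 1,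
    (q.1 - (a0 + z.2 * v)) * Real.cos z.1 + (q.2 - (a1 + z.2 * w)) * Real.sin z.1 = 0}

lemma measurable_parSet (a0 a1 v w : ℝ) : MeasurableSet (parSet a0 a1 v w) := by
  have hK : IsCompact (Icc (0:ℝ) 1 ×ˢ Icc (0:ℝ) 1) := isCompact_Icc.prod isCompact_Icc
  have : CompactSpace (Icc (0:ℝ) 1 ×ˢ Icc (0:ℝ) 1 : Set (ℝ × ℝ)) := isCompact_iff_compactSpace.1 hK
  let C : Set ((Icc (0:ℝ) 1 ×ˢ Icc (0:ℝ) 1 : Set (ℝ × ℝ)) × (ℝ × ℝ)) :=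
    {y | (y.1.1.1 - (a0 + y.2.2 * v)) * Real.cos y.2.1 + (y.1.1.2 - (a1 + y.2.2 * w)) * Real.sin y.2.1 = 0}
  have hC : IsClosed C := isClosed_eq (by fun_prop) continuous_const
  have h2 : IsClosed (Prod.snd '' C) := isClosedMap_snd_of_compactSpace _ hC
  have : parSet a0 a1 v w = (Ico 0 Real.pi ×ˢ Icc (0:ℝ) 1) ∩ Prod.snd '' C := by
    ext z
    constructor
    · rintro ⟨h1, h2, q, hq, e⟩
      exact ⟨⟨h1, h2⟩, (⟨q, hq⟩, z), e, rfl⟩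
    · rintro ⟨⟨h1, h2⟩, ⟨q, z'⟩, e, rfl⟩
      exact ⟨h1, h2, q.1, q.2, e⟩
  rw [this]
  exact (measurableSet_Ico.prod measurableSet_Icc).inter h2.measurableSet

def parMap (a0 a1 v w : ℝ) (z : ℝ × ℝ) : ℝ × ℝ :=
  (z.1, (a0 + z.2 * v) * Real.cos z.1 + (a1 + z.2 * w) * Real.sin z.1)

def parDer (a0 a1 v w : ℝ) (z : ℝ × ℝ) : ℝ × ℝ →L[ℝ] ℝ × ℝ :=
  (Matrix.toLin (.finTwoProd ℝ) (.finTwoProd ℝ)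
    !![1, 0; -(a0 + z.2 * v) * Real.sin z.1 + (a1 + z.2 * w) * Real.cos z.1,
      v * Real.cos z.1 + w * Real.sin z.1]).toContinuousLinearMap

lemma parMap_hasFDerivAt (a0 a1 v w : ℝ) (z : ℝ × ℝ) :
    HasFDerivAt (parMap a0 a1 v w) (parDer a0 a1 v w z) z := by
  unfold parDer
  rw [Matrix.toLin_finTwoProd_toContinuousLinearMap]
  have h1 : HasFDerivAt (fun z : ℝ × ℝ => z.1) (ContinuousLinearMap.fst ℝ ℝ ℝ) z := hasFDerivAt_fst
  have h2 : HasFDerivAt (fun z : ℝ × ℝ => z.2) (ContinuousLinearMap.snd ℝ ℝ ℝ) z := hasFDerivAt_snd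
  have hc := (Real.hasDerivAt_cos z.1).comp_hasFDerivAt z h1
  have hs := (Real.hasDerivAt_sin z.1).comp_hasFDerivAt z h1
  have := h1.prodMk ((((h2.mul_const v).const_add a0).mul hc).add (((h2.mul_const w).const_add a1).mul hs))
  refine HasFDerivAt.congr_fderiv (f := parMap a0 a1 v w) this ?_
  ext <;> simp <;> ring

lemma parDer_det (a0 a1 v w : ℝ) (z : ℝ × ℝ) :
    (parDer a0 a1 v w z).det = v * Real.cos z.1 + w * Real.sin z.1 := by
  unfold parDer
  rw [LinearMap.det_toContinuousLinearMap, LinearMap.det_toLin, Matrix.det_fin_two_of]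
  ring

lemma two_sin : 2 * Real.sin (Real.arctan 500) = (1/4 + 10 ^ (-6 : ℤ) : ℝ) ^ (-(1/2) : ℝ) := by
  rw [Real.rpow_neg (by norm_num), ← Real.sqrt_eq_rpow, Real.sin_arctan,
    show (1/4 + 10 ^ (-6 : ℤ) : ℝ) = (1 + 500 ^ 2) / 1000 ^ 2 by norm_num,
    Real.sqrt_div (by norm_num), Real.sqrt_sq (by norm_num), inv_div]
  ring

lemma const_lt : (1/4 + 10 ^ (-6 : ℤ) : ℝ) ^ (-(1/2) : ℝ) < 2 := by
  rw [← two_sin]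
  have : Real.sin (Real.arctan 500) < Real.sin (Real.pi / 2) :=
    Real.sin_lt_sin_of_lt_of_le_pi_div_two (by linarith [Real.neg_pi_div_two_lt_arctan 500]) le_rfl
      (Real.arctan_lt_pi_div_two _)
  rw [Real.sin_pi_div_two] at this
  linarith

lemma lines_subset (a b : Pt) : linesMeetingBoth (segment ℝ a b) unitSquare ⊆
    parMap (a 0) (a 1) (b 0 - a 0) (b 1 - a 1) '' parSet (a 0) (a 1) (b 0 - a 0) (b 1 - a 1) := by
  rintro ⟨α, p⟩ ⟨hα, ⟨x, hx, hxs⟩, ⟨q, hq, hqU⟩⟩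
  rw [segment_eq_image'] at hxs
  obtain ⟨t, ht, rfl⟩ := hxs
  simp only [paramLine, mem_ofPred_eq, PiLp.add_apply, PiLp.smul_apply, PiLp.sub_apply, smul_eq_mul] at hx hq
  refine ⟨(α, t), ⟨hα, ht, (q 0, q 1), hqU, ?_⟩, ?_⟩
  · simp only
    linear_combination hq - hx
  · simp only [parMap]
    rw [hx]

/-- Corollary 1: for a segment s = [a,b] disjoint from U₂, the measure of
all lines meeting both s and the unit square U is at most (1/4 + 10⁻⁶)^(−1/2) · |s|,
which is strictly less than 2|s|. -/
theorem measure_lines_meeting_U_and_far_segment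
    (a b : Pt) (hab : a ≠ b)
    (hdisj : Disjoint (segment ℝ a b) U2) :
    volume (linesMeetingBoth (segment ℝ a b) unitSquare)
      ≤ ENNReal.ofReal (((1/4 + 10 ^ (-6 : ℤ) : ℝ) ^ (-(1/2) : ℝ)) * ‖b - a‖) ∧
    ((1/4 + 10 ^ (-6 : ℤ) : ℝ) ^ (-(1/2) : ℝ)) * ‖b - a‖ < 2 * ‖b - a‖ := by
  have hpos : 0 < ‖b - a‖ := norm_pos_iff.2 (sub_ne_zero.2 hab.symm)
  refine ⟨?_, mul_lt_mul_of_pos_right const_lt hpos⟩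
  set v := b 0 - a 0 with hv
  set w := b 1 - a 1 with hw
  set T := parSet (a 0) (a 1) v w with hT
  have hTm : MeasurableSet T := measurable_parSet _ _ _ _
  have hnorm : ‖b - a‖ = √(v ^ 2 + w ^ 2) := by
    rw [EuclideanSpace.norm_eq, Fin.sum_univ_two]
    simp [hv, hw]
  have hcont : Continuous fun z : ℝ × ℝ => ENNReal.ofReal |v * Real.cos z.1 + w * Real.sin z.1| :=
    ENNReal.continuous_ofReal.comp (by fun_prop)
  have h500 : 0 ≤ Real.arctan 500 := Real.arctan_nonneg.2 (by norm_num)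
  rw [← two_sin, hnorm]
  set C := ENNReal.ofReal (2 * Real.sin (Real.arctan 500) * √(v ^ 2 + w ^ 2)) with hC
  calc volume (linesMeetingBoth (segment ℝ a b) unitSquare)
      ≤ volume (parMap (a 0) (a 1) v w '' T) := measure_mono (lines_subset a b)
    _ ≤ ∫⁻ z in T, ENNReal.ofReal |(parDer (a 0) (a 1) v w z).det| :=
        addHaar_image_le_lintegral_abs_det_fderiv volume hTm
          fun z _ => (parMap_hasFDerivAt _ _ _ _ z).hasFDerivWithinAt
    _ = ∫⁻ z, T.indicator (fun z => ENNReal.ofReal |v * Real.cos z.1 + w * Real.sin z.1|) z := by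
        simp_rw [parDer_det]
        rw [lintegral_indicator hTm]
    _ = ∫⁻ t, ∫⁻ α, T.indicator (fun z => ENNReal.ofReal |v * Real.cos z.1 + w * Real.sin z.1|) (α, t) := by
        rw [Measure.volume_eq_prod, lintegral_prod_symm' _ (hcont.measurable.indicator hTm)]
    _ ≤ ∫⁻ t, (Icc (0:ℝ) 1).indicator (fun _ => C) t := by
        apply lintegral_mono
        intro t
        simp only
        by_cases ht : t ∈ Icc (0:ℝ) 1
        · rw [indicator_of_mem ht]
          have hx : a + t • (b - a) ∈ segment ℝ a b := by
            rw [segment_eq_image']; exact ⟨t, ht, rfl⟩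
          have hx2 := Set.disjoint_left.1 hdisj hx
          have hout : a 0 + t * v < -(1/1000) ∨ 1 + 1/1000 < a 0 + t * v ∨
              a 1 + t * w < -(1/1000) ∨ 1 + 1/1000 < a 1 + t * w := by
            by_contra hcon
            push Not at hcon
            apply hx2
            obtain ⟨c1, c2, c3, c4⟩ := hcon
            have e3 : (10:ℝ) ^ (-3 : ℤ) = 1 / 1000 := by norm_num
            simp only [U2, mem_ofPred_eq, PiLp.add_apply, PiLp.smul_apply, PiLp.sub_apply, smul_eq_mul, e3]
            exact ⟨⟨c1, c2⟩, ⟨c3, c4⟩⟩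
          have hvol := vol_angSet _ _ hout
          have hb := lintegral_bathtub _ h500 (Real.arctan_lt_pi_div_two 500).le v w _
            (fun α h => h.1) hvol
          have hAm : MeasurableSet (angSet (a 0 + t * v) (a 1 + t * w)) := by
            have : angSet (a 0 + t * v) (a 1 + t * w) = (fun α : ℝ => (α, t)) ⁻¹' T := by
              ext α
              exact ⟨fun h => ⟨h.1, ht, h.2⟩, fun h => ⟨h.1, h.2.2⟩⟩
            rw [this]
            exact measurable_prodMk_right hTm
          rw [← lintegral_indicator hAm] at hb
          refine le_trans (lintegral_mono fun α => ?_) hb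
          simp only
          by_cases hm : (α, t) ∈ T
          · rw [indicator_of_mem hm, indicator_of_mem (show α ∈ angSet _ _ from ⟨hm.1, hm.2.2⟩)]
          · rw [indicator_of_notMem hm]; exact zero_le
        · rw [indicator_of_notMem ht]
          have : ∀ α, (α, t) ∉ T := fun α h => ht h.2.1
          simp [this]
    _ = C := by
        rw [lintegral_indicator measurableSet_Icc]
        simp
end
end
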